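/- Let n, m be positive integers, let A be a real n×n matrix and B a real n×m matrix such that the pair (A,B) satisfies the Kalman condition, let Q be a symmetric positive definite real n×n matrix, U a symmetric positive definite real m×m matrix, and let x^d, x₀ ∈ ℝⁿ, u^d ∈ ℝᵐ. Let (x̄, λ̄) ∈ ℝⁿ × ℝⁿ be the unique solution of the static system A x̄ + B U⁻¹ Bᵀ λ̄ + B u^d = 0 and Q x̄ − Aᵀ λ̄ − Q x^d = 0, and set ū = u^d + U⁻¹ Bᵀ λ̄. Then there exist constants C₁ > 0 and C₂ > 0 such that for every T > 0, the unique continuously differentiable solution (x_T, λ_T) : [0,T] → ℝⁿ × ℝⁿ of x_T'(t) = A x_T(t) + B U⁻¹ Bᵀ λ_T(t) + B u^d, λ_T'(t) = Q x_T(t) − Aᵀ λ_T(t) − Q x^d with x_T(0) = x₀ and λ_T(T) = 0 satisfies, with u_T(t) = u^d + U⁻¹ Bᵀ λ_T(t), the turnpike estimate ‖x_T(t) − x̄‖ + ‖λ_T(t) − λ̄‖ + ‖u_T(t) − ū‖ ≤ C₁ (e^{−C₂ t} + e^{−C₂ (T−t)}) for every t ∈ [0,T]. -/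

import Mathlib

open Matrix Set

/-- The Euclidean norm of a vector in `Fin d → ℝ`. -/
noncomputable def euclNorm {d : ℕ} (v : Fin d → ℝ) : ℝ :=
  ‖(EuclideanSpace.equiv (Fin d) ℝ).symm v‖

/-- Solutions of a linear autonomous equation are transported by the exponential. -/
theorem eq_exp_smul_of_hasDerivWithinAt {E : Type*} [NormedAddCommGroup E] [NormedSpace ℝ E]
    [CompleteSpace E] (H : E →L[ℝ] E) {a b : ℝ} {z : ℝ → E}
    (hz : ∀ t ∈ Icc a b, HasDerivWithinAt z (H (z t)) (Icc a b) t)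
    {s t : ℝ} (hs : s ∈ Icc a b) (ht : t ∈ Icc a b) :
    z t = NormedSpace.exp ((t - s) • H) (z s) := by
  have hg : ∀ r ∈ Icc a b, HasDerivWithinAt (fun r => NormedSpace.exp ((t - r) • H) (z r)) 0
      (Icc a b) r := by
    intro r hr
    have h₁ : HasDerivAt (fun r => NormedSpace.exp ((t - r) • H))
        ((-1 : ℝ) • (NormedSpace.exp ((t - r) • H) * H)) r :=
      (hasDerivAt_exp_smul_const (𝕂 := ℝ) H (t - r)).scomp r
        (by simpa using (hasDerivAt_id r).const_sub t)
    simpa using h₁.hasDerivWithinAt.clm_apply (hz r hr)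
  have hst := (convex_Icc a b).is_const_of_fderivWithin_eq_zero (𝕜 := ℝ)
    (fun r hr => (hg r hr).differentiableWithinAt)
    (fun r hr => by
      by_cases hu : UniqueDiffWithinAt ℝ (Icc a b) r
      · rw [(hg r hr).hasFDerivWithinAt.fderivWithin hu]; ext; simp
      · exact fderivWithin_zero_of_not_uniqueDiffWithinAt hu) ht hs
  simpa [NormedSpace.exp_zero] using hst

theorem hasDerivAt_exp_smul_apply {E : Type*} [NormedAddCommGroup E] [NormedSpace ℝ E]
    [CompleteSpace E] (H : E →L[ℝ] E) (v : E) (t : ℝ) :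
    HasDerivAt (fun r : ℝ => NormedSpace.exp (r • H) v) (H (NormedSpace.exp (t • H) v)) t := by
  simpa using (hasDerivAt_exp_smul_const' (𝕂 := ℝ) H t).clm_apply (hasDerivAt_const t v)

theorem exists_norm_exp_smul_sub_one_le {E : Type*} [NormedAddCommGroup E] [NormedSpace ℝ E]
    [CompleteSpace E] (H : E →L[ℝ] E) :
    ∃ τ > (0 : ℝ), ∀ s ∈ Icc 0 τ, ‖NormedSpace.exp (s • H) - 1‖ ≤ 1 / 2 := by
  have hc : ContinuousAt (fun s : ℝ => NormedSpace.exp (s • H)) 0 :=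
    (hasDerivAt_exp_smul_const (𝕂 := ℝ) H 0).continuousAt
  obtain ⟨δ, hδ, h⟩ := Metric.continuousAt_iff.1 hc (1 / 2) (by norm_num)
  refine ⟨δ / 2, by positivity, fun s hs => ?_⟩
  have := h (x := s) (by rw [Real.dist_eq, sub_zero, abs_of_nonneg hs.1]; linarith [hs.2])
  rw [dist_eq_norm] at this
  simpa [NormedSpace.exp_zero] using this.le

/-- A positive definite continuous form of degree two is coercive in finite dimension. -/
theorem exists_pos_mul_sq_norm_le {E : Type*} [NormedAddCommGroup E] [NormedSpace ℝ E]
    [FiniteDimensional ℝ E] {q : E → ℝ} (hq : Continuous q)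
    (hsmul : ∀ (r : ℝ) (v : E), q (r • v) = r ^ 2 * q v) (hpos : ∀ v, v ≠ 0 → 0 < q v) :
    ∃ c > 0, ∀ v, c * ‖v‖ ^ 2 ≤ q v := by
  have : ProperSpace E := FiniteDimensional.proper ℝ E
  have h0 : q 0 = 0 := by simpa using hsmul 0 0
  obtain ⟨c, hc, hmin⟩ : ∃ c > 0, ∀ v ∈ Metric.sphere (0 : E) 1, c ≤ q v := by
    rcases (Metric.sphere (0 : E) 1).eq_empty_or_nonempty with he | hne
    · exact ⟨1, one_pos, by simp [he]⟩
    · obtain ⟨w, hw, hw'⟩ := (isCompact_sphere (0 : E) 1).exists_isMinOn hne hq.continuousOn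
      refine ⟨q w, hpos w ?_, fun v hv => hw' hv⟩
      rintro rfl
      simp at hw
  refine ⟨c, hc, fun v => ?_⟩
  rcases eq_or_ne v 0 with rfl | hv
  · simp [h0]
  · have hn : 0 < ‖v‖ := norm_pos_iff.2 hv
    have h₁ := hmin (‖v‖⁻¹ • v) (by simp [norm_smul, hn.ne'])
    rw [hsmul] at h₁
    calc c * ‖v‖ ^ 2 ≤ ‖v‖⁻¹ ^ 2 * q v * ‖v‖ ^ 2 := by gcongr
      _ = q v := by field_simp

theorem le_mul_exp_of_expanding {f : ℝ → ℝ} {T τ μ D : ℝ} (hτ : 0 < τ) (hμ : 0 ≤ μ) (hD : 0 ≤ D)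
    (hf : ∀ t ∈ Icc 0 T, f t ≤ D)
    (hexp : ∀ t, 0 ≤ t → t + τ ≤ T → Real.exp (μ * τ) * f t ≤ f (t + τ)) :
    ∀ t ∈ Icc 0 T, f t ≤ D * Real.exp (μ * τ) * Real.exp (-μ * (T - t)) := by
  have key : ∀ k : ℕ, ∀ t ∈ Icc 0 T, T - t ≤ k * τ →
      f t ≤ D * Real.exp (μ * τ) * Real.exp (-μ * (T - t)) := by
    intro k
    have hshort : ∀ t ∈ Icc 0 T, T - t ≤ τ →
        f t ≤ D * Real.exp (μ * τ) * Real.exp (-μ * (T - t)) := by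
      intro t ht h
      refine (hf t ht).trans ?_
      rw [mul_assoc, ← Real.exp_add]
      refine le_mul_of_one_le_right hD (Real.one_le_exp ?_)
      nlinarith
    induction k with
    | zero => exact fun t ht h => hshort t ht (by simp at h; linarith)
    | succ k ih =>
      intro t ht h
      by_cases hT : T - t ≤ τ
      · exact hshort t ht hT
      · push_cast at h
        have h₁ := ih (t + τ) ⟨by linarith [ht.1], by linarith⟩ (by linarith)
        have h₂ := (hexp t ht.1 (by linarith)).trans h₁
        have h₃ : Real.exp (-μ * (T - (t + τ))) = Real.exp (μ * τ) * Real.exp (-μ * (T - t)) := by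
          rw [← Real.exp_add]; ring_nf
        rw [h₃] at h₂
        refine le_of_mul_le_mul_left (h₂.trans_eq ?_) (Real.exp_pos (μ * τ))
        ring
  intro t ht
  obtain ⟨k, hk⟩ := exists_nat_ge ((T - t) / τ)
  exact key k t ht ((div_le_iff₀ hτ).1 hk)

/-- Dissipation of a quadratic quantity over windows of length `τ` forces a curve to stay near the
origin except close to the two ends of the time interval. -/
theorem sq_norm_le_of_dissipation {E : Type*} [NormedAddCommGroup E] {V : E → ℝ} {z : ℝ → E}
    {T τ c K R μ : ℝ} (hτ : 0 < τ) (hτT : τ ≤ T) (hc : 0 < c) (hK : 0 < K) (hR : 0 ≤ R)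
    (hμ : 0 ≤ μ) (hμc : Real.exp (μ * τ) = 1 + 4 * c / (9 * K))
    (hmono : MonotoneOn (fun t => V (z t)) (Icc 0 T))
    (hdiss : ∀ s, 0 ≤ s → s + τ ≤ T → c * ‖z s‖ ^ 2 ≤ V (z (s + τ)) - V (z s))
    (hshort : ∀ s t, 0 ≤ s → s ≤ t → t ≤ s + τ → t ≤ T → ‖z t‖ ≤ 3 / 2 * ‖z s‖)
    (hV : ∀ v, |V v| ≤ K * ‖v‖ ^ 2) (hV0 : |V (z 0)| ≤ R * ‖z 0‖) (hVT : |V (z T)| ≤ R * ‖z T‖) :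
    ∀ t ∈ Icc 0 T, ‖z t‖ ^ 2 ≤
      (9 / (4 * c)) * (R * (9 * R / (2 * c)) * Real.exp (μ * τ) * Real.exp (μ * τ)) *
        (Real.exp (-μ * t) + Real.exp (-μ * (T - t))) := by
  have hT : 0 ≤ T := hτ.le.trans hτT
  have hz0 : c * ‖z 0‖ ^ 2 ≤ V (z T) - V (z 0) := by
    have h₁ := hdiss 0 le_rfl (by linarith)
    have h₂ := hmono (a := 0 + τ) (b := T) ⟨by linarith, by linarith⟩ ⟨hT, le_rfl⟩ (by linarith)
    simp only at h₂
    linarith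
  have hzT : 4 / 9 * c * ‖z T‖ ^ 2 ≤ V (z T) - V (z 0) := by
    have h₁ := hdiss (T - τ) (by linarith) (by linarith)
    have h₂ := hmono (a := 0) (b := T - τ) ⟨le_rfl, hT⟩ ⟨by linarith, by linarith⟩ (by linarith)
    have h₃ := hshort (T - τ) T (by linarith) (by linarith) (by linarith) le_rfl
    simp only [sub_add_cancel] at h₁ h₂
    have h₄ : ‖z T‖ ^ 2 ≤ (3 / 2 * ‖z (T - τ)‖) ^ 2 := by gcongr
    nlinarith
  have hVT' := (abs_le.1 hVT).2
  have hV0' := (abs_le.1 hV0).1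
  obtain ⟨hN0, hNT⟩ : ‖z 0‖ ≤ 9 * R / (2 * c) ∧ ‖z T‖ ≤ 9 * R / (2 * c) := by
    rw [le_div_iff₀ (by positivity), le_div_iff₀ (by positivity)]
    have h0 := norm_nonneg (z 0)
    have hT := norm_nonneg (z T)
    rcases le_total ‖z 0‖ ‖z T‖ with h | h
    · have : ‖z T‖ * (2 * c) ≤ 9 * R := by
        rcases hT.eq_or_lt with h' | h'
        · rw [← h']; linarith
        · refine le_of_mul_le_mul_right ?_ h'
          nlinarith
      exact ⟨by nlinarith, this⟩
    · have : ‖z 0‖ * (2 * c) ≤ 9 * R := by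
        rcases h0.eq_or_lt with h' | h'
        · rw [← h']; linarith
        · refine le_of_mul_le_mul_right ?_ h'
          nlinarith
      exact ⟨this, by nlinarith⟩
  set D := R * (9 * R / (2 * c))
  have hD : 0 ≤ D := by positivity
  have hDT : V (z T) ≤ D := hVT'.trans (mul_le_mul_of_nonneg_left hNT hR)
  have hD0 : -V (z 0) ≤ D := by
    have : R * ‖z 0‖ ≤ D := mul_le_mul_of_nonneg_left hN0 hR
    linarith
  have hgrow : ∀ s, 0 ≤ s → s + τ ≤ T →
      4 * c / (9 * K) * |V (z s)| ≤ V (z (s + τ)) - V (z s) ∧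
      4 * c / (9 * K) * |V (z (s + τ))| ≤ V (z (s + τ)) - V (z s) := by
    intro s hs hsT
    have h₁ := hdiss s hs hsT
    have h₂ := hshort s (s + τ) hs (by linarith) le_rfl hsT
    have h₃ : ‖z (s + τ)‖ ^ 2 ≤ (3 / 2 * ‖z s‖) ^ 2 := by gcongr
    constructor
    · calc 4 * c / (9 * K) * |V (z s)| ≤ 4 * c / (9 * K) * (K * ‖z s‖ ^ 2) := by gcongr; exact hV _
        _ = 4 / 9 * (c * ‖z s‖ ^ 2) := by field_simp
        _ ≤ _ := by nlinarith [mul_nonneg hc.le (sq_nonneg ‖z s‖)]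
    · calc 4 * c / (9 * K) * |V (z (s + τ))| ≤ 4 * c / (9 * K) * (K * ‖z (s + τ)‖ ^ 2) := by
            gcongr; exact hV _
        _ ≤ 4 * c / (9 * K) * (K * (3 / 2 * ‖z s‖) ^ 2) := by gcongr
        _ = c * ‖z s‖ ^ 2 := by field_simp; norm_num
        _ ≤ _ := h₁
  have hκ : 0 < 4 * c / (9 * K) := by positivity
  have hup := le_mul_exp_of_expanding (f := fun t => V (z t)) hτ hμ hD
    (fun t ht => (hmono ht ⟨hT, le_rfl⟩ ht.2).trans hDT)
    (fun t ht htT => by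
      rw [hμc]
      have := (hgrow t ht htT).1
      have := mul_le_mul_of_nonneg_left (le_abs_self (V (z t))) hκ.le
      linarith)
  have hlow := le_mul_exp_of_expanding (f := fun t => -V (z (T - t))) (T := T) hτ hμ hD
    (fun t ht => by
      have := hmono (a := 0) (b := T - t) ⟨le_rfl, hT⟩ ⟨by linarith [ht.2], by linarith [ht.1]⟩
        (by linarith [ht.2])
      simp only at this ⊢
      linarith)
    (fun t ht htT => by
      rw [hμc]
      have h₁ := (hgrow (T - (t + τ)) (by linarith) (by linarith)).2
      rw [show T - (t + τ) + τ = T - t by ring] at h₁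
      have := mul_le_mul_of_nonneg_left (neg_abs_le (V (z (T - t)))) hκ.le
      linarith)
  intro t ht
  obtain ⟨s, hs0, hsT, hst, hts⟩ : ∃ s, 0 ≤ s ∧ s + τ ≤ T ∧ s ≤ t ∧ t ≤ s + τ := by
    by_cases h : t + τ ≤ T
    · exact ⟨t, ht.1, h, le_rfl, by linarith⟩
    · exact ⟨T - τ, by linarith, by linarith, by linarith, by linarith [ht.2]⟩
  have h₁ := hdiss s hs0 hsT
  have h₂ := hshort s t hs0 hst hts ht.2
  have h₃ := hup (s + τ) ⟨by linarith, hsT⟩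
  have h₄ := hlow (T - s) ⟨by linarith, by linarith⟩
  simp only [sub_sub_cancel] at h₃ h₄
  have h₅ : Real.exp (-μ * (T - (s + τ))) ≤ Real.exp (μ * τ) * Real.exp (-μ * (T - t)) := by
    rw [← Real.exp_add]; apply Real.exp_le_exp.2; nlinarith
  have h₆ : Real.exp (-μ * s) ≤ Real.exp (μ * τ) * Real.exp (-μ * t) := by
    rw [← Real.exp_add]; apply Real.exp_le_exp.2; nlinarith
  have hDe : 0 ≤ D * Real.exp (μ * τ) := by positivity
  have h₇ := mul_le_mul_of_nonneg_left h₅ hDe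
  have h₈ := mul_le_mul_of_nonneg_left h₆ hDe
  calc ‖z t‖ ^ 2 ≤ (3 / 2 * ‖z s‖) ^ 2 := by gcongr
    _ = 9 / (4 * c) * (c * ‖z s‖ ^ 2) := by field_simp; ring
    _ ≤ 9 / (4 * c) * (D * Real.exp (μ * τ) * (Real.exp (μ * τ) * Real.exp (-μ * t))
          + D * Real.exp (μ * τ) * (Real.exp (μ * τ) * Real.exp (-μ * (T - t)))) := by
        gcongr; linarith
    _ = _ := by ring

theorem abs_dotProduct_le_mul_norm {n : ℕ} (v w : Fin n → ℝ) : |v ⬝ᵥ w| ≤ n * (‖v‖ * ‖w‖) := by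
  calc |v ⬝ᵥ w| ≤ ∑ i, |v i * w i| := Finset.abs_sum_le_sum_abs _ _
    _ ≤ ∑ _i : Fin n, ‖v‖ * ‖w‖ := by
        refine Finset.sum_le_sum fun i _ => ?_
        rw [abs_mul]
        exact mul_le_mul (norm_le_pi_norm v i) (norm_le_pi_norm w i) (abs_nonneg _) (norm_nonneg _)
    _ = n * (‖v‖ * ‖w‖) := by simp

theorem exists_euclNorm_le (d : ℕ) : ∃ M > 0, ∀ v : Fin d → ℝ, euclNorm v ≤ M * ‖v‖ := by
  obtain ⟨M, hM, h⟩ :=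
    ((EuclideanSpace.equiv (Fin d) ℝ).symm : (Fin d → ℝ) →L[ℝ] EuclideanSpace ℝ (Fin d)).bound
  exact ⟨M, hM, h⟩

theorem HasDerivWithinAt.dotProduct_apply {n : ℕ} {x y : ℝ → Fin n → ℝ} {x' y' : Fin n → ℝ}
    {s : Set ℝ} {t : ℝ} (hx : HasDerivWithinAt x x' s t) (hy : HasDerivWithinAt y y' s t) :
    HasDerivWithinAt (fun r => x r ⬝ᵥ y r) (x' ⬝ᵥ y t + x t ⬝ᵥ y') s t := by
  have := HasDerivWithinAt.fun_sum (u := Finset.univ)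
    fun i _ => (hasDerivWithinAt_pi.1 hx i).mul (hasDerivWithinAt_pi.1 hy i)
  simpa [dotProduct, Finset.sum_add_distrib] using this

/-- The matrix `[[A, S], [Q, -Aᵀ]]` acting on pairs of vectors. -/
noncomputable def hamiltonianCLM {n : ℕ} (A S Q : Matrix (Fin n) (Fin n) ℝ) :
    ((Fin n → ℝ) × (Fin n → ℝ)) →L[ℝ] ((Fin n → ℝ) × (Fin n → ℝ)) :=
  LinearMap.toContinuousLinearMap
    ((A.mulVecLin ∘ₗ LinearMap.fst ℝ _ _ + S.mulVecLin ∘ₗ LinearMap.snd ℝ _ _).prod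
      (Q.mulVecLin ∘ₗ LinearMap.fst ℝ _ _ - Aᵀ.mulVecLin ∘ₗ LinearMap.snd ℝ _ _))

theorem hamiltonianCLM_apply {n : ℕ} (A S Q : Matrix (Fin n) (Fin n) ℝ)
    (z : (Fin n → ℝ) × (Fin n → ℝ)) :
    hamiltonianCLM A S Q z = (A *ᵥ z.1 + S *ᵥ z.2, Q *ᵥ z.1 - Aᵀ *ᵥ z.2) := rfl

theorem hasDerivWithinAt_dotProduct_of_hamiltonian {n : ℕ} {A S Q : Matrix (Fin n) (Fin n) ℝ}
    {z : ℝ → (Fin n → ℝ) × (Fin n → ℝ)} {s : Set ℝ} {t : ℝ}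
    (hz : HasDerivWithinAt z (hamiltonianCLM A S Q (z t)) s t) :
    HasDerivWithinAt (fun r => (z r).1 ⬝ᵥ (z r).2)
      ((z t).2 ⬝ᵥ S *ᵥ (z t).2 + (z t).1 ⬝ᵥ Q *ᵥ (z t).1) s t := by
  have h₁ : HasDerivWithinAt (fun r => (z r).1) (A *ᵥ (z t).1 + S *ᵥ (z t).2) s t :=
    (ContinuousLinearMap.fst ℝ (Fin n → ℝ) (Fin n → ℝ)).hasFDerivAt.comp_hasDerivWithinAt t hz
  have h₂ : HasDerivWithinAt (fun r => (z r).2) (Q *ᵥ (z t).1 - Aᵀ *ᵥ (z t).2) s t :=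
    (ContinuousLinearMap.snd ℝ (Fin n → ℝ) (Fin n → ℝ)).hasFDerivAt.comp_hasDerivWithinAt t hz
  convert h₁.dotProduct_apply h₂ using 1
  rw [add_dotProduct, dotProduct_sub, mulVec_transpose, dotProduct_comm (A *ᵥ (z t).1),
    dotProduct_comm (S *ᵥ (z t).2), dotProduct_comm (z t).1 ((z t).2 ᵥ* A), ← dotProduct_mulVec]
  ring

theorem eq_zero_of_kalman {n m : ℕ} {A : Matrix (Fin n) (Fin n) ℝ} {B : Matrix (Fin n) (Fin m) ℝ}
    (hK : (Matrix.of fun (i : Fin n) (p : Fin n × Fin m) => (A ^ (p.1 : ℕ) * B) i p.2).rank = n)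
    {w : Fin n → ℝ} (hw : ∀ k : ℕ, (w ᵥ* A ^ k) ᵥ* B = 0) : w = 0 := by
  set M := Matrix.of fun (i : Fin n) (p : Fin n × Fin m) => (A ^ (p.1 : ℕ) * B) i p.2
  have hker : Mᵀ.mulVecLin.ker = ⊥ := by
    have h₁ := Mᵀ.mulVecLin.finrank_range_add_finrank_ker
    have h₂ : Module.finrank ℝ Mᵀ.mulVecLin.range = n :=
      (Matrix.rank_transpose M).trans hK
    rw [h₂, Module.finrank_fin_fun] at h₁
    exact Submodule.finrank_eq_zero.1 (by omega)
  have hmem : w ∈ Mᵀ.mulVecLin.ker := by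
    rw [LinearMap.mem_ker, Matrix.mulVecLin_apply, mulVec_transpose]
    ext p
    have := congrFun (hw p.1) p.2
    rw [vecMul_vecMul] at this
    exact this
  rw [hker] at hmem
  exact (Submodule.mem_bot ℝ).1 hmem

theorem dotProduct_congruence_mulVec {n m : ℕ} (B : Matrix (Fin n) (Fin m) ℝ)
    (W : Matrix (Fin m) (Fin m) ℝ) (p : Fin n → ℝ) :
    p ⬝ᵥ (B * W * Bᵀ) *ᵥ p = (p ᵥ* B) ⬝ᵥ W *ᵥ (p ᵥ* B) := by
  rw [← mulVec_mulVec, ← mulVec_mulVec, mulVec_transpose, dotProduct_mulVec]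

theorem Matrix.PosDef.dotProduct_mulVec_self_nonneg {d : ℕ} {W : Matrix (Fin d) (Fin d) ℝ}
    (hW : W.PosDef) (v : Fin d → ℝ) : 0 ≤ v ⬝ᵥ W *ᵥ v := by
  simpa using hW.posSemidef.dotProduct_mulVec_nonneg v

theorem Matrix.PosDef.eq_zero_of_dotProduct_mulVec_self {d : ℕ} {W : Matrix (Fin d) (Fin d) ℝ}
    (hW : W.PosDef) {v : Fin d → ℝ} (hv : v ⬝ᵥ W *ᵥ v = 0) : v = 0 := by
  by_contra h
  exact (hW.dotProduct_mulVec_pos h).ne' (by simpa using hv)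

/-- A solution of the Hamiltonian system along which the duality product takes the same value at
both ends of a nontrivial interval vanishes. -/
theorem eq_zero_of_dotProduct_eq {n m : ℕ} {A : Matrix (Fin n) (Fin n) ℝ}
    {B : Matrix (Fin n) (Fin m) ℝ}
    (hK : (Matrix.of fun (i : Fin n) (p : Fin n × Fin m) => (A ^ (p.1 : ℕ) * B) i p.2).rank = n)
    {Q : Matrix (Fin n) (Fin n) ℝ} {W : Matrix (Fin m) (Fin m) ℝ} (hQ : Q.PosDef) (hW : W.PosDef)
    {z : ℝ → (Fin n → ℝ) × (Fin n → ℝ)} {a b : ℝ} (hab : a < b)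
    (hz : ∀ t ∈ Icc a b,
      HasDerivWithinAt z (hamiltonianCLM A (B * W * Bᵀ) Q (z t)) (Icc a b) t)
    (hmono : MonotoneOn (fun t => (z t).1 ⬝ᵥ (z t).2) (Icc a b))
    (heq : (z b).1 ⬝ᵥ (z b).2 = (z a).1 ⬝ᵥ (z a).2) :
    z a = 0 := by
  have hconst : ∀ t ∈ Icc a b, (z t).1 ⬝ᵥ (z t).2 = (z a).1 ⬝ᵥ (z a).2 := fun t ht =>
    le_antisymm ((hmono ht ⟨hab.le, le_rfl⟩ ht.2).trans heq.le)
      (hmono ⟨le_rfl, hab.le⟩ ht ht.1)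
  have hz' : ∀ t ∈ Ioo a b, HasDerivAt z (hamiltonianCLM A (B * W * Bᵀ) Q (z t)) t :=
    fun t ht => (hz t (Ioo_subset_Icc_self ht)).hasDerivAt (Icc_mem_nhds ht.1 ht.2)
  have hzero : ∀ t ∈ Ioo a b, (z t).1 = 0 ∧ (z t).2 ᵥ* B = 0 := by
    intro t ht
    have h₁ := hasDerivWithinAt_univ.1 (hasDerivWithinAt_dotProduct_of_hamiltonian
      (hz' t ht).hasDerivWithinAt)
    have h₂ : HasDerivAt (fun r => (z r).1 ⬝ᵥ (z r).2) 0 t :=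
      (hasDerivAt_const t _).congr_of_eventuallyEq (Filter.eventuallyEq_of_mem
        (Icc_mem_nhds ht.1 ht.2) hconst)
    have h₃ := h₁.unique h₂
    rw [dotProduct_congruence_mulVec] at h₃
    have h₄ := hW.dotProduct_mulVec_self_nonneg ((z t).2 ᵥ* B)
    have h₅ := hQ.dotProduct_mulVec_self_nonneg (z t).1
    exact ⟨hQ.eq_zero_of_dotProduct_mulVec_self (by linarith),
      hW.eq_zero_of_dotProduct_mulVec_self (by linarith)⟩
  have hp : ∀ t ∈ Ioo a b, HasDerivAt (fun r => (z r).2) (-((z t).2 ᵥ* A)) t := by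
    intro t ht
    have h := (ContinuousLinearMap.snd ℝ (Fin n → ℝ) (Fin n → ℝ)).hasFDerivAt.comp_hasDerivAt t
      (hz' t ht)
    simpa [hamiltonianCLM_apply, (hzero t ht).1, mulVec_transpose, Function.comp_def] using h
  have hB : ∀ k : ℕ, ∀ t ∈ Ioo a b, ((z t).2 ᵥ* A ^ k) ᵥ* B = 0 := by
    intro k
    induction k with
    | zero => intro t ht; simpa using (hzero t ht).2
    | succ k ih =>
      intro t ht
      let L : (Fin n → ℝ) →L[ℝ] (Fin m → ℝ) :=
        LinearMap.toContinuousLinearMap (A ^ k * B).vecMulLinear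
      have hL : ∀ v, L v = (v ᵥ* A ^ k) ᵥ* B := fun v => (vecMul_vecMul v (A ^ k) B).symm
      have h₁ := L.hasFDerivAt.comp_hasDerivAt t (hp t ht)
      have h₂ : HasDerivAt (L ∘ fun r => (z r).2) 0 t :=
        (hasDerivAt_const t (0 : Fin m → ℝ)).congr_of_eventuallyEq (Filter.eventuallyEq_of_mem
          (Ioo_mem_nhds ht.1 ht.2) fun r hr => (hL _).trans (ih r hr))
      have h₃ := h₁.unique h₂
      rw [map_neg, neg_eq_zero, hL, vecMul_vecMul _ A, ← pow_succ'] at h₃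
      exact h₃
  have hmid : (a + b) / 2 ∈ Ioo a b := ⟨by linarith, by linarith⟩
  have hzmid : z ((a + b) / 2) = 0 :=
    Prod.ext (hzero _ hmid).1 (eq_zero_of_kalman hK fun k => hB k _ hmid)
  rw [eq_exp_smul_of_hasDerivWithinAt _ hz (Ioo_subset_Icc_self hmid) ⟨le_rfl, hab.le⟩, hzmid,
    map_zero]

theorem monotoneOn_dotProduct_of_hamiltonian {n m : ℕ} {A : Matrix (Fin n) (Fin n) ℝ}
    {B : Matrix (Fin n) (Fin m) ℝ} {Q : Matrix (Fin n) (Fin n) ℝ} {W : Matrix (Fin m) (Fin m) ℝ}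
    (hQ : Q.PosDef) (hW : W.PosDef) {z : ℝ → (Fin n → ℝ) × (Fin n → ℝ)} {a b : ℝ}
    (hz : ∀ t ∈ Icc a b,
      HasDerivWithinAt z (hamiltonianCLM A (B * W * Bᵀ) Q (z t)) (Icc a b) t) :
    MonotoneOn (fun t => (z t).1 ⬝ᵥ (z t).2) (Icc a b) := by
  have hd := fun t ht => hasDerivWithinAt_dotProduct_of_hamiltonian (hz t ht)
  refine monotoneOn_of_hasDerivWithinAt_nonneg (convex_Icc a b)
    (fun t ht => (hd t ht).continuousWithinAt)
    (fun t ht => (hd t (interior_subset ht)).mono interior_subset) fun t _ => ?_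
  rw [dotProduct_congruence_mulVec]
  exact add_nonneg (hW.dotProduct_mulVec_self_nonneg _) (hQ.dotProduct_mulVec_self_nonneg _)

/-- Exponential turnpike estimate for the homogeneous Hamiltonian system, with bounds that are
uniform in the horizon. -/
theorem exists_turnpike_hamiltonian {n m : ℕ} (hn : 0 < n) {A : Matrix (Fin n) (Fin n) ℝ}
    {B : Matrix (Fin n) (Fin m) ℝ}
    (hK : (Matrix.of fun (i : Fin n) (p : Fin n × Fin m) => (A ^ (p.1 : ℕ) * B) i p.2).rank = n)
    {Q : Matrix (Fin n) (Fin n) ℝ} {W : Matrix (Fin m) (Fin m) ℝ} (hQ : Q.PosDef) (hW : W.PosDef)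
    (y₀ p₁ : Fin n → ℝ) :
    ∃ C > 0, ∃ ν > 0, ∀ T > 0, ∀ z : ℝ → (Fin n → ℝ) × (Fin n → ℝ),
      (∀ t ∈ Icc 0 T, HasDerivWithinAt z (hamiltonianCLM A (B * W * Bᵀ) Q (z t)) (Icc 0 T) t) →
      (z 0).1 = y₀ → (z T).2 = p₁ → ∀ t ∈ Icc 0 T,
        ‖z t‖ ≤ C * (Real.exp (-ν * t) + Real.exp (-ν * (T - t))) := by
  set H := hamiltonianCLM A (B * W * Bᵀ) Q
  obtain ⟨τ, hτ, hexp⟩ := exists_norm_exp_smul_sub_one_le H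
  have hclose : ∀ s ∈ Icc 0 τ, ∀ v, ‖NormedSpace.exp (s • H) v - v‖ ≤ 1 / 2 * ‖v‖ := by
    intro s hs v
    exact (NormedSpace.exp (s • H) - 1).le_of_opNorm_le (hexp s hs) v
  set V : (Fin n → ℝ) × (Fin n → ℝ) → ℝ := fun v => v.1 ⬝ᵥ v.2 with hVdef
  have hVcont : Continuous V := continuous_fst.dotProduct continuous_snd
  have hVsmul : ∀ (r : ℝ) v, V (r • v) = r ^ 2 * V v := by
    intro r v
    simp only [hVdef, Prod.smul_fst, Prod.smul_snd, smul_dotProduct, dotProduct_smul, smul_eq_mul]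
    ring
  obtain ⟨c, hc, hdiss⟩ := exists_pos_mul_sq_norm_le
    (q := fun v => V (NormedSpace.exp (τ • H) v) - V v)
    ((hVcont.comp (NormedSpace.exp (τ • H)).continuous).sub hVcont)
    (fun r v => by simp only [map_smul, hVsmul]; ring)
    (fun v hv => by
      have hz : ∀ t ∈ Icc 0 τ, HasDerivWithinAt (fun r : ℝ => NormedSpace.exp (r • H) v)
          (H (NormedSpace.exp (t • H) v)) (Icc 0 τ) t :=
        fun t _ => (hasDerivAt_exp_smul_apply H v t).hasDerivWithinAt
      have hmono := monotoneOn_dotProduct_of_hamiltonian hQ hW hz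
      have hle := hmono ⟨le_rfl, hτ.le⟩ ⟨hτ.le, le_rfl⟩ hτ.le
      have hne : V (NormedSpace.exp (τ • H) v) ≠ V v := fun h => hv <| by
        simpa [NormedSpace.exp_zero] using eq_zero_of_dotProduct_eq hK hQ hW hτ hz hmono
          (by simpa [NormedSpace.exp_zero] using h)
      simp only [zero_smul, NormedSpace.exp_zero, one_apply_eq_self] at hle
      exact sub_pos.2 (lt_of_le_of_ne hle hne.symm))
  have hn' : (0 : ℝ) < n := Nat.cast_pos.2 hn
  have hκ : 0 < 4 * c / (9 * n) := by positivity
  set μ := Real.log (1 + 4 * c / (9 * n)) / τ with hμdef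
  have hμ : 0 < μ := div_pos (Real.log_pos (by linarith)) hτ
  have hμc : Real.exp (μ * τ) = 1 + 4 * c / (9 * n) := by
    rw [hμdef, div_mul_cancel₀ _ hτ.ne', Real.exp_log (by linarith)]
  set R : ℝ := n * (‖y₀‖ + ‖p₁‖) with hR
  have hR0 : 0 ≤ R := by positivity
  set K := (9 / (4 * c)) * (R * (9 * R / (2 * c)) * Real.exp (μ * τ) * Real.exp (μ * τ)) with hKdef
  have hK0 : 0 ≤ K := by positivity
  set N := 3 / 2 * (2 * ‖y₀‖ + 2 * ‖p₁‖) * Real.exp (μ / 2 * τ) with hN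
  have hN0 : 0 ≤ N := by positivity
  refine ⟨√K + N + 1, by positivity, μ / 2, by positivity, ?_⟩
  intro T hT z hz hz0 hzT t ht
  have hflow := fun {s t : ℝ} (hs : s ∈ Icc 0 T) (ht : t ∈ Icc 0 T) =>
    eq_exp_smul_of_hasDerivWithinAt H hz hs ht
  have hshort' : ∀ s t, 0 ≤ s → s ≤ t → t ≤ s + τ → t ≤ T → ‖z t - z s‖ ≤ 1 / 2 * ‖z s‖ := by
    intro s t hs hst hts htT
    rw [hflow ⟨hs, by linarith⟩ ⟨hs.trans hst, htT⟩]
    exact hclose _ ⟨by linarith, by linarith⟩ _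
  have hshort : ∀ s t, 0 ≤ s → s ≤ t → t ≤ s + τ → t ≤ T → ‖z t‖ ≤ 3 / 2 * ‖z s‖ := by
    intro s t hs hst hts htT
    have h₁ := hshort' s t hs hst hts htT
    have h₂ := norm_sub_norm_le (z t) (z s)
    linarith
  have he₁ := Real.exp_pos (-(μ / 2) * t)
  have he₂ := Real.exp_pos (-(μ / 2) * (T - t))
  rcases le_total τ T with hτT | hτT
  · have hmain := sq_norm_le_of_dissipation (V := V) hτ hτT hc hn' hR0 hμ.le hμc
      (monotoneOn_dotProduct_of_hamiltonian hQ hW hz)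
      (fun s hs hsT => by
        rw [hflow (s := s) (t := s + τ) ⟨hs, by linarith⟩ ⟨by linarith, hsT⟩, add_sub_cancel_left]
        exact hdiss (z s))
      hshort
      (fun v => (abs_dotProduct_le_mul_norm _ _).trans (by
        rw [sq]
        gcongr
        · exact norm_fst_le v
        · exact norm_snd_le v))
      ((abs_dotProduct_le_mul_norm _ _).trans (by
        rw [hz0, hR, mul_assoc]
        gcongr
        · linarith [norm_nonneg p₁]
        · exact norm_snd_le _))
      ((abs_dotProduct_le_mul_norm _ _).trans (by
        rw [hzT, hR, mul_assoc, mul_comm ‖(z T).1‖]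
        gcongr
        · linarith [norm_nonneg y₀]
        · exact norm_fst_le _)) t ht
    rw [← hKdef] at hmain
    have hsq : ‖z t‖ ≤ √K * (Real.exp (-(μ / 2) * t) + Real.exp (-(μ / 2) * (T - t))) := by
      refine abs_le_of_sq_le_sq' ?_ (by positivity) |>.2
      refine hmain.trans ?_
      rw [mul_pow, Real.sq_sqrt hK0]
      gcongr
      have h₁ : Real.exp (-μ * t) = Real.exp (-(μ / 2) * t) ^ 2 := by
        rw [← Real.exp_nat_mul]; congr 1; push_cast; ring
      have h₂ : Real.exp (-μ * (T - t)) = Real.exp (-(μ / 2) * (T - t)) ^ 2 := by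
        rw [← Real.exp_nat_mul]; congr 1; push_cast; ring
      rw [h₁, h₂]
      nlinarith
    refine hsq.trans ?_
    gcongr
    linarith
  · have h₁ := hshort 0 t le_rfl ht.1 (by linarith [ht.2]) ht.2
    have h₂ := hshort' 0 T le_rfl hT.le (by linarith) le_rfl
    have h₃ : ‖z 0‖ ≤ ‖y₀‖ + ‖(z 0).2‖ := by
      rw [← hz0, Prod.norm_def]
      exact max_le_add_of_nonneg (norm_nonneg _) (norm_nonneg _)
    have h₄ : ‖(z 0).2‖ ≤ ‖p₁‖ + ‖z T - z 0‖ := by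
      have h₅ := norm_snd_le (z T - z 0)
      have h₆ := norm_sub_norm_le (z 0).2 p₁
      rw [Prod.snd_sub, hzT, norm_sub_rev] at h₅
      linarith
    have h₅ : ‖z t‖ ≤ 3 / 2 * (2 * ‖y₀‖ + 2 * ‖p₁‖) := by linarith
    have h₆ : 1 ≤ Real.exp (μ / 2 * τ) * Real.exp (-(μ / 2) * t) := by
      rw [← Real.exp_add]
      apply Real.one_le_exp
      nlinarith [ht.2]
    calc ‖z t‖ ≤ 3 / 2 * (2 * ‖y₀‖ + 2 * ‖p₁‖) * 1 := by linarith
      _ ≤ 3 / 2 * (2 * ‖y₀‖ + 2 * ‖p₁‖) * (Real.exp (μ / 2 * τ) * Real.exp (-(μ / 2) * t)) := by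
          gcongr
      _ = N * Real.exp (-(μ / 2) * t) := by rw [hN]; ring
      _ ≤ (√K + N + 1) * (Real.exp (-(μ / 2) * t) + Real.exp (-(μ / 2) * (T - t))) := by
          gcongr
          · linarith [Real.sqrt_nonneg K]
          · linarith

theorem stmt_17 (n m : ℕ) (hn : 0 < n) (hm : 0 < m)
    (A : Matrix (Fin n) (Fin n) ℝ) (B : Matrix (Fin n) (Fin m) ℝ)
    (hK : (Matrix.of fun (i : Fin n) (p : Fin n × Fin m) =>
        (A ^ (p.1 : ℕ) * B) i p.2).rank = n)
    (Q : Matrix (Fin n) (Fin n) ℝ) (U : Matrix (Fin m) (Fin m) ℝ)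
    (hQ : Q.PosDef) (hU : U.PosDef)
    (xd x₀ : Fin n → ℝ) (ud : Fin m → ℝ)
    (xbar lbar : Fin n → ℝ)
    (hstatic₁ : A.mulVec xbar + (B * U⁻¹ * Bᵀ).mulVec lbar + B.mulVec ud = 0)
    (hstatic₂ : Q.mulVec xbar - Aᵀ.mulVec lbar - Q.mulVec xd = 0) :
    ∃ C₁ > (0 : ℝ), ∃ C₂ > (0 : ℝ), ∀ T > (0 : ℝ), ∀ x l : ℝ → (Fin n → ℝ),
      (∀ t ∈ Icc (0 : ℝ) T, HasDerivWithinAt x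
          (A.mulVec (x t) + (B * U⁻¹ * Bᵀ).mulVec (l t) + B.mulVec ud) (Icc 0 T) t) →
      (∀ t ∈ Icc (0 : ℝ) T, HasDerivWithinAt l
          (Q.mulVec (x t) - Aᵀ.mulVec (l t) - Q.mulVec xd) (Icc 0 T) t) →
      x 0 = x₀ → l T = 0 →
      ∀ t ∈ Icc (0 : ℝ) T,
        euclNorm (x t - xbar) + euclNorm (l t - lbar)
            + euclNorm ((ud + (U⁻¹ * Bᵀ).mulVec (l t)) - (ud + (U⁻¹ * Bᵀ).mulVec lbar))
          ≤ C₁ * (Real.exp (-C₂ * t) + Real.exp (-C₂ * (T - t))) := by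
  obtain ⟨C, hC, ν, hν, hmain⟩ := exists_turnpike_hamiltonian hn hK hQ hU.inv (x₀ - xbar) (-lbar)
  obtain ⟨M, hM, hMn⟩ := exists_euclNorm_le n
  obtain ⟨M', hM', hMm⟩ := exists_euclNorm_le m
  obtain ⟨G, hG, hGv⟩ := (LinearMap.toContinuousLinearMap (U⁻¹ * Bᵀ).mulVecLin).bound
  refine ⟨(2 * M + M' * G) * C, by positivity, ν, hν, ?_⟩
  intro T hT x l hx hl hx0 hlT t ht
  have hz := hmain T hT (fun r => (x r - xbar, l r - lbar))
    (fun r hr => by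
      have h := ((hx r hr).sub_const xbar).prodMk ((hl r hr).sub_const lbar)
      convert h using 1
      rw [hamiltonianCLM_apply]
      ext1
      · linear_combination -hstatic₁ + mulVec_sub A (x r) xbar
          + mulVec_sub (B * U⁻¹ * Bᵀ) (l r) lbar
      · linear_combination -hstatic₂ + mulVec_sub Q (x r) xbar
          - mulVec_sub Aᵀ (l r) lbar)
    (by simp [hx0]) (by simp [hlT]) t ht
  have h₁ := norm_fst_le (x t - xbar, l t - lbar)
  have h₂ := norm_snd_le (x t - xbar, l t - lbar)
  simp only at h₁ h₂ hz
  have h₃ : euclNorm ((ud + (U⁻¹ * Bᵀ) *ᵥ l t) - (ud + (U⁻¹ * Bᵀ) *ᵥ lbar))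
      ≤ M' * (G * ‖(x t - xbar, l t - lbar)‖) := by
    rw [add_sub_add_left_eq_sub, ← mulVec_sub]
    refine (hMm _).trans ?_
    gcongr
    exact (hGv (l t - lbar)).trans (by gcongr)
  calc _ ≤ M * ‖(x t - xbar, l t - lbar)‖ + M * ‖(x t - xbar, l t - lbar)‖
        + M' * (G * ‖(x t - xbar, l t - lbar)‖) := by
        gcongr
        · exact (hMn _).trans (by gcongr)
        · exact (hMn _).trans (by gcongr)
    _ = (2 * M + M' * G) * ‖(x t - xbar, l t - lbar)‖ := by ring
    _ ≤ (2 * M + M' * G) * (C * (Real.exp (-ν * t) + Real.exp (-ν * (T - t)))) := by gcongr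
    _ = _ := by ring
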